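/- arXiv:2508.02318 — 2 statements merged into one kernel-verified Lean document; each statement's English description precedes it below -/
import Mathlib

section
/- Let M(n) denote the number of ψ-amicable pairs (a, b) with a < b and a ≤ n, i.e. the number of pairs of positive integers a < b with a ≤ n satisfying ψ(a) = ψ(b) = a + b. Then M(n) = o(n) as n → ∞; equivalently, M(n)/n → 0 as n → ∞. -/
open Filter

/-- The Dedekind psi function: `ψ(n) = n ∏_{p ∣ n} (1 + 1/p)`, with `ψ(1) = 1`. -/
def psi (n : ℕ) : ℕ := (n / ∏ p ∈ n.primeFactors, p) * ∏ p ∈ n.primeFactors, (p + 1)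

/-- The number of ψ-amicable pairs `(a, b)` with `a < b` and `a ≤ n`. -/
noncomputable def M (n : ℕ) : ℕ :=
  Nat.card {q : ℕ × ℕ // 0 < q.1 ∧ q.1 < q.2 ∧ q.1 ≤ n ∧
    psi q.1 = q.1 + q.2 ∧ psi q.2 = q.1 + q.2}

section PrimesInResidueClass

open ArithmeticFunction.vonMangoldt

/-- The reciprocals of the primes in an invertible residue class are not summable. -/
lemma not_summable_one_div_primes_residueClass {q : ℕ} [NeZero q] {a : ZMod q} (ha : IsUnit a) :
    ¬ Summable ({p : ℕ | p.Prime ∧ (p : ZMod q) = a}.indicator fun n : ℕ ↦ (1 : ℝ) / n) := by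
  intro H
  set u := {p : ℕ | p.Prime ∧ (p : ZMod q) = a}.indicator fun n : ℕ ↦ (1 : ℝ) / n with hu
  have hu0 (n : ℕ) : 0 ≤ u n := Set.indicator_nonneg (fun _ _ ↦ by positivity) n
  obtain ⟨C, hC⟩ := LSeries_residueClass_lower_bound ha
  set c := (q.totient : ℝ)⁻¹
  have hc : 0 < c := inv_pos.mpr (mod_cast q.totient.pos_of_neZero)
  obtain ⟨N, hN⟩ := H.nat_tsum_vanishing (Iio_mem_nhds (half_pos hc))
  have htail := hN _ subset_rfl
  rw [tsum_subtype, Set.mem_Iio] at htail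
  set v := {n : ℕ | N ≤ n}.indicator u with hvdef
  have hv : Summable v := H.indicator _
  have hv0 (n : ℕ) : 0 ≤ v n := Set.indicator_nonneg (fun m _ ↦ hu0 m) n
  set w : ℕ → ℝ := fun n ↦ if n < N then residueClass a n / n else 0 with hw
  have hw0 (n : ℕ) : 0 ≤ w n := by
    rw [hw]; dsimp only
    split_ifs
    · have := residueClass_nonneg a n
      positivity
    · exact le_rfl
  have hwsum : Summable w := by
    refine summable_of_ne_finset_zero (s := Finset.range N) fun n hn ↦ ?_
    simp only [hw, Finset.mem_range] at hn ⊢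
    rw [if_neg hn]
  set r : ℕ → ℝ := fun n ↦ (if n.Prime then 0 else residueClass a n) / n with hr
  have hr0 (n : ℕ) : 0 ≤ r n := by
    have := residueClass_nonneg a n
    rw [hr]; dsimp only
    positivity
  have hrsum : Summable r := summable_residueClass_non_primes_div a
  have hpow {x : ℝ} (hx : 1 < x) (n : ℕ) :
      residueClass a n / (n : ℝ) ^ x ≤ residueClass a n / n := by
    rcases n.eq_zero_or_pos with rfl | hn
    · simp
    · refine div_le_div_of_nonneg_left (residueClass_nonneg a _) (mod_cast hn) ?_
      conv_lhs => rw [← Real.rpow_one n]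
      exact Real.rpow_le_rpow_of_exponent_le (by norm_cast) hx.le
  have hterm {x : ℝ} (hx : 1 < x) (n : ℕ) :
      residueClass a n / (n : ℝ) ^ x ≤ r n + w n + v n / (x - 1) := by
    have hx' : 0 < x - 1 := sub_pos.mpr hx
    have hvx : 0 ≤ v n / (x - 1) := div_nonneg (hv0 n) hx'.le
    by_cases hnN : n < N
    · have : w n = residueClass a n / n := if_pos hnN
      linarith [hpow hx n, hr0 n]
    by_cases hp : n.Prime
    · have hn : (0 : ℝ) < n := mod_cast hp.pos
      by_cases hna : (n : ZMod q) = a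
      · have hv' : v n = 1 / n := by
          rw [hvdef, Set.indicator_of_mem (show n ∈ {n : ℕ | N ≤ n} from not_lt.mp hnN), hu,
            Set.indicator_of_mem (show n ∈ {p : ℕ | p.Prime ∧ (p : ZMod q) = a} from ⟨hp, hna⟩)]
        have hres : residueClass a n = Real.log n := by
          rw [residueClass, Set.indicator_of_mem (show n ∈ {n : ℕ | (n : ZMod q) = a} from hna),
            ArithmeticFunction.vonMangoldt_apply_prime hp]
        have hlog : Real.log n ≤ (n : ℝ) ^ (x - 1) / (x - 1) :=
          Real.log_le_rpow_div hn.le hx'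
        have : residueClass a n / (n : ℝ) ^ x ≤ v n / (x - 1) := by
          rw [hv', hres]
          calc Real.log n / (n : ℝ) ^ x ≤ ((n : ℝ) ^ (x - 1) / (x - 1)) / (n : ℝ) ^ x := by gcongr
            _ = 1 / n / (x - 1) := by
              rw [Real.rpow_sub_one hn.ne']
              have := (Real.rpow_pos_of_pos hn x).ne'
              field_simp
        linarith [hr0 n, hw0 n]
      · have : residueClass a n = 0 := Set.indicator_of_notMem (by exact hna) _
        rw [this, zero_div]
        linarith [hr0 n, hw0 n]
    · have : r n = residueClass a n / n := by simp only [hr, if_neg hp]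
      linarith [hpow hx n, hw0 n]
  set K := ∑' n, r n + ∑' n, w n + C
  have hbound {x : ℝ} (hx : x ∈ Set.Ioc 1 2) : c / 2 ≤ K * (x - 1) := by
    have hx' : 0 < x - 1 := sub_pos.mpr hx.1
    have hrw := hrsum.add hwsum
    have hvx := hv.div_const (x - 1)
    have h1 : ∑' n, residueClass a n / (n : ℝ) ^ x ≤ ∑' n, (r n + w n + v n / (x - 1)) :=
      Summable.tsum_le_tsum (hterm hx.1)
        (LSeries.summable_real_of_abscissaOfAbsConv_lt <|
          (abscissaOfAbsConv_residueClass_le_one a).trans_lt <| mod_cast hx.1)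
        (hrw.add hvx)
    rw [hrw.tsum_add hvx, hrsum.tsum_add hwsum, tsum_div_const] at h1
    have h2 := (hC hx).trans h1
    have h3 : (∑' n, v n) / (x - 1) ≤ c / 2 / (x - 1) := by gcongr
    have h4 : c / (x - 1) - c / 2 / (x - 1) ≤ K := by linarith
    rw [← sub_div, div_le_iff₀ hx'] at h4
    linarith
  have hK : 0 < K := by
    have := hbound (Set.right_mem_Ioc.mpr one_lt_two)
    linarith
  have hmin : 0 < min 1 (c / (4 * K)) := by positivity
  have := hbound (x := 1 + min 1 (c / (4 * K)))
    ⟨by linarith, by linarith [min_le_left 1 (c / (4 * K))]⟩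
  have h5 : K * (1 + min 1 (c / (4 * K)) - 1) ≤ K * (c / (4 * K)) := by
    rw [add_sub_cancel_left]
    gcongr
    exact min_le_right _ _
  have h6 : K * (c / (4 * K)) = c / 4 := by field_simp
  linarith

end PrimesInResidueClass

section Sieve

open Finset

/-- If the reciprocals of a set of primes are not summable, then all but a small proportion of the
integers have a divisor in a suitable finite part of that set. -/
lemma exists_finset_eventually_card_forall_not_dvd_le {Q : Set ℕ} (hQ : ∀ p ∈ Q, p.Prime)
    (hdiv : ¬ Summable (Q.indicator fun n : ℕ ↦ (1 : ℝ) / n)) {η : ℝ} (hη : 0 < η) :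
    ∃ T : Finset ℕ, (∀ p ∈ T, p ∈ Q) ∧
      ∀ᶠ x : ℕ in atTop, (#{a ∈ Ioc 0 x | ∀ p ∈ T, ¬ p ∣ a} : ℝ) ≤ η * x := by
  classical
  obtain ⟨s, hs⟩ : ∃ s : Finset ℕ,
      Real.log (2 / η) < ∑ n ∈ s, Q.indicator (fun n : ℕ ↦ (1 : ℝ) / n) n := by
    by_contra! h
    exact hdiv (summable_of_sum_le (fun n ↦ Set.indicator_nonneg (fun _ _ ↦ by positivity) n) h)
  set T := {p ∈ s | p ∈ Q} with hT
  have hTQ (p : ℕ) (hp : p ∈ T) : p ∈ Q := (mem_filter.mp hp).2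
  have hTp (p : ℕ) (hp : p ∈ T) : p.Prime := hQ p (hTQ p hp)
  refine ⟨T, hTQ, ?_⟩
  have hsum : Real.log (2 / η) < ∑ p ∈ T, (1 : ℝ) / p := by
    simpa only [hT, sum_filter, Set.indicator_apply] using hs
  set N := ∏ p ∈ T, p with hN
  have hN0 : 0 < N := prod_pos fun p hp ↦ (hTp p hp).pos
  have hNR : (0 : ℝ) < N := mod_cast hN0
  have htot : (N.totient : ℝ) ≤ N * (η / 2) := by
    have h1 : (N.totient : ℝ) = N * ∏ p ∈ T, (1 - (p : ℝ)⁻¹) := by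
      have := Nat.totient_eq_mul_prod_factors N
      rw [hN, Nat.primeFactors_prod hTp, ← hN] at this
      have h := congrArg (Rat.cast : ℚ → ℝ) this
      push_cast at h
      exact h
    rw [h1]
    gcongr
    calc ∏ p ∈ T, (1 - (p : ℝ)⁻¹) ≤ ∏ p ∈ T, Real.exp (-(1 / (p : ℝ))) := by
          refine prod_le_prod (fun p hp ↦ ?_) fun p hp ↦ ?_
          · have : (1 : ℝ) ≤ p := mod_cast (hTp p hp).one_le
            linarith [inv_le_one_of_one_le₀ this]
          · rw [one_div]
            exact Real.one_sub_le_exp_neg _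
      _ = Real.exp (-∑ p ∈ T, 1 / (p : ℝ)) := by rw [← Real.exp_sum, sum_neg_distrib]
      _ ≤ Real.exp (-Real.log (2 / η)) := by gcongr
      _ = η / 2 := by rw [Real.exp_neg, Real.exp_log (by positivity), inv_div]
  filter_upwards [eventually_ge_atTop ⌈(N : ℝ) * 2 / η⌉₊] with x hx
  have hx' : (N : ℝ) * 2 / η ≤ x := (Nat.le_ceil _).trans (mod_cast hx)
  have hsub : #{a ∈ Ioc 0 x | ∀ p ∈ T, ¬ p ∣ a} ≤ #{a ∈ Ico 1 (1 + x) | N.Coprime a} := by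
    refine card_le_card fun a ha ↦ ?_
    simp only [mem_filter, mem_Ioc, mem_Ico] at ha ⊢
    refine ⟨by omega, Nat.Coprime.prod_left fun p hp ↦ ?_⟩
    exact (Nat.Prime.coprime_iff_not_dvd (hTp p hp)).mpr (ha.2 p hp)
  have hcount := hsub.trans (Nat.Ico_filter_coprime_le 1 x hN0.ne')
  calc (#{a ∈ Ioc 0 x | ∀ p ∈ T, ¬ p ∣ a} : ℝ)
      ≤ (N.totient * (x / N + 1) : ℕ) := mod_cast hcount
    _ ≤ N.totient * ((x : ℝ) / N + 1) := by
        push_cast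
        gcongr
        exact Nat.cast_div_le
    _ = N.totient * ((x : ℝ) / N) + N.totient := by ring
    _ ≤ N * (η / 2) * ((x : ℝ) / N) + N := by
        gcongr
        exact Nat.totient_le N
    _ = η / 2 * x + N := by field_simp
    _ ≤ η * x := by
        rw [div_le_iff₀ hη] at hx'
        linarith

lemma card_multiples_le (x d : ℕ) : (#{a ∈ Ioc 0 x | d ∣ a} : ℝ) ≤ x / d := by
  rw [Nat.Ioc_filter_dvd_card_eq_div]
  exact Nat.cast_div_le

lemma sum_Ioc_div_sq_le {z : ℕ} (hz : z ≠ 0) (x : ℕ) :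
    ∑ n ∈ Ioc z x, (x : ℝ) / n ^ 2 ≤ x / z := by
  rcases le_total z x with h | h
  · simp only [div_eq_mul_inv, ← mul_sum]
    gcongr
    have := sum_Ioc_inv_sq_le_sub (α := ℝ) hz h
    have h0 : (0 : ℝ) ≤ (x : ℝ)⁻¹ := by positivity
    linarith
  · rw [Ioc_eq_empty (by omega), sum_empty]
    positivity

open scoped Classical in
/-- Few integers are divisible by the square of an integer exceeding `z`. -/
lemma card_exists_sq_dvd_le {z : ℕ} (hz : z ≠ 0) (x : ℕ) :
    (#{a ∈ Ioc 0 x | ∃ n, z < n ∧ n ^ 2 ∣ a} : ℝ) ≤ x / z := by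
  classical
  refine le_trans ?_ (sum_Ioc_div_sq_le hz x)
  have hsub : {a ∈ Ioc 0 x | ∃ n, z < n ∧ n ^ 2 ∣ a} ⊆
      (Ioc z x).biUnion fun n ↦ {a ∈ Ioc 0 x | n ^ 2 ∣ a} := by
    intro a ha
    simp only [mem_filter, mem_Ioc, mem_biUnion] at ha ⊢
    obtain ⟨⟨ha0, hax⟩, n, hzn, hn⟩ := ha
    exact ⟨n, ⟨hzn, (Nat.le_self_pow two_ne_zero n).trans ((Nat.le_of_dvd ha0 hn).trans hax)⟩,
      ⟨ha0, hax⟩, hn⟩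
  calc (#{a ∈ Ioc 0 x | ∃ n, z < n ∧ n ^ 2 ∣ a} : ℝ)
      ≤ (∑ n ∈ Ioc z x, #{a ∈ Ioc 0 x | n ^ 2 ∣ a} : ℕ) :=
        mod_cast (card_le_card hsub).trans card_biUnion_le
    _ ≤ ∑ n ∈ Ioc z x, (x : ℝ) / n ^ 2 := by
        push_cast
        gcongr with n
        exact_mod_cast card_multiples_le x (n ^ 2)

end Sieve

section PsiRatio

open Finset

/-- The ratio `ψ(n) / n = ∏_{p ∣ n} (1 + 1/p)`. -/
noncomputable def psiRatio (n : ℕ) : ℝ := ∏ p ∈ n.primeFactors, (1 + 1 / (p : ℝ))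

lemma psi_eq_mul_psiRatio (n : ℕ) : (psi n : ℝ) = n * psiRatio n := by
  have h0 : (∏ p ∈ n.primeFactors, (p : ℝ)) ≠ 0 :=
    prod_ne_zero_iff.mpr fun p hp ↦ mod_cast (Nat.prime_of_mem_primeFactors hp).ne_zero
  have h1 : psiRatio n = (∏ p ∈ n.primeFactors, ((p : ℝ) + 1)) / ∏ p ∈ n.primeFactors, (p : ℝ) := by
    rw [psiRatio, ← prod_div_distrib]
    refine prod_congr rfl fun p hp ↦ ?_
    have : (p : ℝ) ≠ 0 := mod_cast (Nat.prime_of_mem_primeFactors hp).ne_zero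
    field_simp
  rw [psi, h1, Nat.cast_mul, Nat.cast_div (Nat.prod_primeFactors_dvd n) (by rwa [Nat.cast_prod])]
  push_cast
  ring

lemma psiRatio_mul_prime {m p : ℕ} (hm : m ≠ 0) (hp : p.Prime) (hpm : ¬ p ∣ m) :
    psiRatio (p * m) = (1 + 1 / (p : ℝ)) * psiRatio m := by
  rw [psiRatio, Nat.primeFactors_mul hp.ne_zero hm, hp.primeFactors, ← insert_eq,
    prod_insert (fun h ↦ hpm (Nat.dvd_of_mem_primeFactors h)), psiRatio]

lemma succ_dvd_psi {a p : ℕ} (ha : a ≠ 0) (hp : p.Prime) (hpa : p ∣ a) : p + 1 ∣ psi a :=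
  (dvd_prod_of_mem (fun p ↦ p + 1) (hp.mem_primeFactors hpa ha)).mul_left _

/-- Distinct primes up to `W` have values of `1 + 1/p` that are too far apart to both bring `f` into
the interval `(2, 2 + 1/(W + 1)²]`. -/
lemma le_of_one_add_one_div_mul_mem {W p r : ℕ} {f : ℝ} (hp : 0 < p) (hr : r ≤ W)
    (h₁ : (1 + 1 / (p : ℝ)) * f ≤ 2 + 1 / ((W : ℝ) + 1) ^ 2)
    (h₂ : 2 < (1 + 1 / (r : ℝ)) * f) : r ≤ p := by
  by_contra! hlt
  have hp' : (0 : ℝ) < p := mod_cast hp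
  have hpr : (p : ℝ) + 1 ≤ r := mod_cast hlt
  have hr' : (0 : ℝ) < r := by linarith
  have hrW : (r : ℝ) ≤ W := mod_cast hr
  have hW : (0 : ℝ) < (W : ℝ) + 1 := by positivity
  have hf : 1 < f := by
    have : 1 + 1 / (r : ℝ) ≤ 2 := by
      have : 1 / (r : ℝ) ≤ 1 := by rw [div_le_one hr']; linarith
      linarith
    by_contra! hf
    rcases le_or_gt f 0 with h0 | h0
    · have : (1 + 1 / (r : ℝ)) * f ≤ 0 := mul_nonpos_of_nonneg_of_nonpos (by positivity) h0
      linarith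
    · nlinarith
  have hdiff : 1 / ((W : ℝ) + 1) ^ 2 ≤ 1 / (p : ℝ) - 1 / r := by
    rw [div_sub_div _ _ hp'.ne' hr'.ne', div_le_div_iff₀ (by positivity) (by positivity)]
    have : (p : ℝ) * r ≤ ((W : ℝ) + 1) ^ 2 := by nlinarith
    nlinarith [sq_nonneg ((W : ℝ) + 1)]
  have hd : 0 < 1 / (p : ℝ) - 1 / r := lt_of_lt_of_le (by positivity) hdiff
  nlinarith

/-- Integers `a` with `ψ(a)/a` slightly above `2` are rare. -/
lemma exists_eventually_card_psiRatio_near_two_le {η : ℝ} (hη : 0 < η) :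
    ∃ δ : ℝ, 0 < δ ∧ ∀ᶠ x : ℕ in atTop,
      (#{a ∈ Ioc 0 x | 2 < psiRatio a ∧ psiRatio a ≤ 2 + δ} : ℝ) ≤ η * x := by
  classical
  obtain ⟨z, hz⟩ := exists_nat_gt (3 / η)
  have hzR : (0 : ℝ) < z := lt_trans (by positivity) hz
  have hz0 : z ≠ 0 := by rintro rfl; simp at hzR
  have hdiv : ¬ Summable ({p : ℕ | p.Prime ∧ z < p}.indicator fun n : ℕ ↦ (1 : ℝ) / n) := by
    intro h
    refine not_summable_one_div_on_primes (h.congr_cofinite ?_)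
    filter_upwards [(Set.finite_Iic z).compl_mem_cofinite] with n hn
    have hn' : z < n := by simpa using hn
    simp [Set.indicator_apply, hn']
  obtain ⟨T, hTQ, hT⟩ := exists_finset_eventually_card_forall_not_dvd_le (fun p hp ↦ hp.1) hdiv
    (show 0 < η / 3 by positivity)
  set W := T.sup id
  have hW (p : ℕ) (hp : p ∈ T) : p ≤ W := le_sup (f := id) hp
  refine ⟨1 / ((W : ℝ) + 1) ^ 2, by positivity, ?_⟩
  filter_upwards [hT] with x hx
  set S := {a ∈ Ioc 0 x | 2 < psiRatio a ∧ psiRatio a ≤ 2 + 1 / ((W : ℝ) + 1) ^ 2}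
  set E := {a ∈ S | ∃ p ∈ T, p ∣ a ∧ ¬ p ^ 2 ∣ a} with hE
  have hEcard : #E ≤ x / z := by
    have hex (a : ℕ) (ha : a ∈ E) : ∃ p ∈ T, p ∣ a ∧ ¬ p ^ 2 ∣ a := (mem_filter.mp ha).2
    choose! g hgT hga hgsq using hex
    have hkey (a : ℕ) (ha : a ∈ E) : 0 < a / g a ∧ g a * (a / g a) = a ∧
        psiRatio a = (1 + 1 / (g a : ℝ)) * psiRatio (a / g a) := by
      have haS := mem_filter.mp (mem_filter.mp ha).1
      have ha0 : 0 < a := (mem_Ioc.mp haS.1).1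
      have hp : (g a).Prime := (hTQ _ (hgT a ha)).1
      have hm : g a * (a / g a) = a := Nat.mul_div_cancel' (hga a ha)
      have hm0 : 0 < a / g a := Nat.div_pos (Nat.le_of_dvd ha0 (hga a ha)) hp.pos
      refine ⟨hm0, hm, ?_⟩
      have hnd : ¬ g a ∣ a / g a := by
        intro h
        refine hgsq a ha ?_
        have := mul_dvd_mul_left (g a) h
        rwa [hm, ← sq] at this
      rw [← psiRatio_mul_prime hm0.ne' hp hnd, hm]
    have hmaps : Set.MapsTo (fun a ↦ a / g a) (E : Set ℕ) (Ioc 0 (x / z) : Finset ℕ) := by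
      intro a ha
      have hax : a ≤ x := (mem_Ioc.mp (mem_filter.mp (mem_filter.mp ha).1).1).2
      rw [mem_coe, mem_Ioc]
      refine ⟨(hkey a ha).1, ?_⟩
      exact Nat.div_le_div hax (hTQ _ (hgT a ha)).2.le hz0
    have hinj : Set.InjOn (fun a ↦ a / g a) (E : Set ℕ) := by
      intro a ha b hb hab
      dsimp only at hab
      obtain ⟨-, hma, hfa⟩ := hkey a ha
      obtain ⟨-, hmb, hfb⟩ := hkey b hb
      obtain ⟨-, hla, hua⟩ := mem_filter.mp (mem_filter.mp ha).1
      obtain ⟨-, hlb, hub⟩ := mem_filter.mp (mem_filter.mp hb).1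
      rw [← hab] at hfb
      rw [hfa] at hla hua
      rw [hfb] at hlb hub
      have hpa := (hTQ _ (hgT a ha)).1.pos
      have hpb := (hTQ _ (hgT b hb)).1.pos
      have h : g a = g b :=
        le_antisymm (le_of_one_add_one_div_mul_mem hpb (hW _ (hgT a ha)) hub hla)
          (le_of_one_add_one_div_mul_mem hpa (hW _ (hgT b hb)) hua hlb)
      rw [← hma, ← hmb, hab, h]
    simpa using card_le_card_of_injOn _ hmaps hinj
  have hsub : S ⊆ {a ∈ Ioc 0 x | ∀ p ∈ T, ¬ p ∣ a} ∪
      {a ∈ Ioc 0 x | ∃ n, z < n ∧ n ^ 2 ∣ a} ∪ E := by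
    intro a ha
    have hax := (mem_filter.mp ha).1
    simp only [mem_union, mem_filter, hE, ha, hax, true_and]
    by_cases h : ∃ p ∈ T, p ∣ a
    · obtain ⟨p, hp, hpa⟩ := h
      by_cases h2 : p ^ 2 ∣ a
      · exact .inl (.inr ⟨p, (hTQ p hp).2, h2⟩)
      · exact .inr ⟨p, hp, hpa, h2⟩
    · push Not at h
      exact .inl (.inl h)
  have hcard : (#S : ℝ) ≤ #{a ∈ Ioc 0 x | ∀ p ∈ T, ¬ p ∣ a} +
      #{a ∈ Ioc 0 x | ∃ n, z < n ∧ n ^ 2 ∣ a} + #E := by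
    exact_mod_cast (card_le_card hsub).trans
      ((card_union_le _ _).trans (Nat.add_le_add_right (card_union_le _ _) _))
  have h1 := card_exists_sq_dvd_le hz0 x
  have h2 : (#E : ℝ) ≤ x / z := le_trans (mod_cast hEcard) Nat.cast_div_le
  have h3 : (x : ℝ) / z ≤ η / 3 * x := by
    rw [div_le_iff₀ hzR]
    rw [div_lt_iff₀ hη] at hz
    have : (0 : ℝ) ≤ x := x.cast_nonneg
    nlinarith
  linarith

/-- For most integers `a`, the large prime factors of `a` contribute little to `ψ(a)/a`. -/
lemma exists_card_sum_large_primeFactors_le {δ η : ℝ} (hδ : 0 < δ) (hη : 0 < η) :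
    ∃ y : ℕ, ∀ x : ℕ,
      (#{a ∈ Ioc 0 x | δ < ∑ p ∈ a.primeFactors with y < p, 1 / (p : ℝ)} : ℝ) ≤ η * x := by
  obtain ⟨y, hy⟩ := exists_nat_gt (1 / (δ * η))
  have hyR : (0 : ℝ) < y := lt_trans (by positivity) hy
  have hy0 : y ≠ 0 := by rintro rfl; simp at hyR
  refine ⟨y, fun x ↦ ?_⟩
  set A := {a ∈ Ioc 0 x | δ < ∑ p ∈ a.primeFactors with y < p, 1 / (p : ℝ)}
  have h1 : δ * #A ≤ x / y := by
    calc δ * #A = ∑ a ∈ A, δ := by rw [sum_const, nsmul_eq_mul, mul_comm]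
      _ ≤ ∑ a ∈ A, ∑ p ∈ a.primeFactors with y < p, 1 / (p : ℝ) :=
          sum_le_sum fun a ha ↦ (mem_filter.mp ha).2.le
      _ ≤ ∑ a ∈ Ioc 0 x, ∑ p ∈ a.primeFactors with y < p, 1 / (p : ℝ) :=
          sum_le_sum_of_subset_of_nonneg (filter_subset _ _) fun _ _ _ ↦
            sum_nonneg fun _ _ ↦ by positivity
      _ ≤ ∑ a ∈ Ioc 0 x, ∑ n ∈ Ioc y x with n ∣ a, 1 / (n : ℝ) := by
          refine sum_le_sum fun a ha ↦ sum_le_sum_of_subset_of_nonneg (fun p hp ↦ ?_)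
            fun _ _ _ ↦ by positivity
          simp only [mem_filter, mem_Ioc] at hp ha ⊢
          have hpa := Nat.dvd_of_mem_primeFactors hp.1
          exact ⟨⟨hp.2, (Nat.le_of_dvd ha.1 hpa).trans ha.2⟩, hpa⟩
      _ = ∑ n ∈ Ioc y x, #{a ∈ Ioc 0 x | n ∣ a} * (1 / (n : ℝ)) := by
          simp only [sum_filter]
          rw [sum_comm]
          refine sum_congr rfl fun n _ ↦ ?_
          rw [← sum_filter, sum_const, nsmul_eq_mul]
      _ ≤ ∑ n ∈ Ioc y x, (x : ℝ) / n ^ 2 := by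
          refine sum_le_sum fun n _ ↦ ?_
          calc _ ≤ (x : ℝ) / n * (1 / n) := by
                gcongr
                exact card_multiples_le x n
            _ = _ := by rw [div_mul_div_comm, mul_one, sq]
      _ ≤ x / y := sum_Ioc_div_sq_le hy0 x
  have h2 : (x : ℝ) / y ≤ δ * (η * x) := by
    rw [div_le_iff₀ hyR]
    rw [div_lt_iff₀ (by positivity)] at hy
    have : (0 : ℝ) ≤ x := x.cast_nonneg
    nlinarith
  exact le_of_mul_le_mul_left (h1.trans h2) hδ

/-- If `a < b` are ψ-amicable, `a + b` is divisible by all small primes, and the large prime factors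
of `a` contribute little to `ψ(a)/a`, then `ψ(a)/a` is slightly above `2`. -/
lemma psiRatio_near_two_of_amicable {a b y : ℕ} {δ : ℝ} (hδ : 0 < δ) (ha : 0 < a) (hab : a < b)
    (hpa : psi a = a + b) (hpb : psi b = a + b) (hy : y.factorial ∣ a + b)
    (hlarge : ∑ p ∈ a.primeFactors with y < p, 1 / (p : ℝ) ≤ Real.log (1 + δ)) :
    2 < psiRatio a ∧ psiRatio a ≤ 2 + δ := by
  have haR : (0 : ℝ) < a := mod_cast ha
  have habR : (a : ℝ) < b := mod_cast hab
  have hfa : (a : ℝ) * psiRatio a = a + b := by rw [← psi_eq_mul_psiRatio, hpa]; push_cast; rfl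
  have hfb : (b : ℝ) * psiRatio b = a + b := by rw [← psi_eq_mul_psiRatio, hpb]; push_cast; rfl
  have hsmall : {p ∈ a.primeFactors | ¬ y < p} ⊆ b.primeFactors := by
    intro p hp
    obtain ⟨hp, hpy⟩ := mem_filter.mp hp
    have hpp := Nat.prime_of_mem_primeFactors hp
    have hdvd : p ∣ a + b := (hpp.dvd_factorial.mpr (not_lt.mp hpy)).trans hy
    exact hpp.mem_primeFactors ((Nat.dvd_add_right (Nat.dvd_of_mem_primeFactors hp)).mp hdvd)
      (by omega)
  have hlargeprod : ∏ p ∈ a.primeFactors with y < p, (1 + 1 / (p : ℝ)) ≤ 1 + δ :=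
    calc _ ≤ ∏ p ∈ a.primeFactors with y < p, Real.exp (1 / (p : ℝ)) :=
          prod_le_prod (fun _ _ ↦ by positivity) fun p _ ↦ by
            rw [add_comm]; exact Real.add_one_le_exp _
      _ = Real.exp (∑ p ∈ a.primeFactors with y < p, 1 / (p : ℝ)) := (Real.exp_sum _ _).symm
      _ ≤ Real.exp (Real.log (1 + δ)) := by gcongr
      _ = 1 + δ := Real.exp_log (by positivity)
  have hsmallprod : ∏ p ∈ a.primeFactors with ¬ y < p, (1 + 1 / (p : ℝ)) ≤ psiRatio b :=
    prod_le_prod_of_subset_of_one_le hsmall (fun _ _ ↦ by positivity)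
      fun p _ _ ↦ le_add_of_nonneg_right (by positivity)
  have hratio : psiRatio a ≤ (1 + δ) * psiRatio b := by
    rw [psiRatio, ← prod_filter_mul_prod_filter_not a.primeFactors (fun p ↦ y < p)]
    exact mul_le_mul hlargeprod hsmallprod (prod_nonneg fun _ _ ↦ by positivity) (by positivity)
  have hb : (b : ℝ) ≤ (1 + δ) * a := by
    have h : (b : ℝ) * (a + b) ≤ (1 + δ) * a * (a + b) :=
      calc (b : ℝ) * (a + b) = (a * b) * psiRatio a := by rw [← hfa]; ring
        _ ≤ (a * b) * ((1 + δ) * psiRatio b) := by gcongr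
        _ = (1 + δ) * a * (a + b) := by rw [← hfb]; ring
    exact le_of_mul_le_mul_right h (by positivity)
  constructor
  · refine lt_of_mul_lt_mul_left ?_ haR.le
    linarith
  · refine le_of_mul_le_mul_left ?_ haR
    linarith

/-- For most integers `a`, the value `ψ(a)` is divisible by a given positive integer. -/
lemma eventually_card_not_dvd_psi_le {m : ℕ} (hm : m ≠ 0) {η : ℝ} (hη : 0 < η) :
    ∀ᶠ x : ℕ in atTop, (#{a ∈ Ioc 0 x | ¬ m ∣ psi a} : ℝ) ≤ η * x := by
  have : NeZero m := ⟨hm⟩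
  obtain ⟨T, hTQ, hT⟩ := exists_finset_eventually_card_forall_not_dvd_le (fun p hp ↦ hp.1)
    (not_summable_one_div_primes_residueClass (isUnit_one.neg : IsUnit (-1 : ZMod m))) hη
  filter_upwards [hT] with x hx
  refine le_trans ?_ hx
  gcongr with a ha
  intro h p hp hpa
  obtain ⟨hpp, hpm⟩ := hTQ p hp
  refine h (dvd_trans ?_ (succ_dvd_psi (mem_Ioc.mp ha).1.ne' hpp hpa))
  rw [← ZMod.natCast_eq_zero_iff]
  push_cast
  rw [hpm, neg_add_cancel]

open scoped Classical in
/-- The larger member of a ψ-amicable pair is determined by the smaller one. -/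
lemma M_le_card (n : ℕ) :
    M n ≤ #{a ∈ Ioc 0 n | ∃ b, a < b ∧ psi a = a + b ∧ psi b = a + b} := by
  set A := {a ∈ Ioc 0 n | ∃ b, a < b ∧ psi a = a + b ∧ psi b = a + b}
  rw [M, ← Nat.card_eq_finsetCard A]
  refine Nat.card_le_card_of_injective
    (fun q ↦ ⟨q.1.1, mem_filter.mpr ⟨mem_Ioc.mpr ⟨q.2.1, q.2.2.2.1⟩, q.1.2, q.2.2.1, q.2.2.2.2⟩⟩) ?_
  rintro ⟨⟨a, b⟩, h⟩ ⟨⟨c, d⟩, h'⟩ heq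
  obtain rfl : a = c := congrArg Subtype.val heq
  have hbd : b = d := by
    have h₁ := h.2.2.2.1
    have h₂ := h'.2.2.2.1
    dsimp only at h₁ h₂
    omega
  subst hbd
  rfl

lemma eventually_M_le {η : ℝ} (hη : 0 < η) : ∀ᶠ x : ℕ in atTop, (M x : ℝ) ≤ η * x := by
  classical
  have hη3 : 0 < η / 3 := by positivity
  obtain ⟨δ, hδ, hnear⟩ := exists_eventually_card_psiRatio_near_two_le hη3
  obtain ⟨y, hy⟩ := exists_card_sum_large_primeFactors_le
    (Real.log_pos (show 1 < 1 + δ by linarith)) hη3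
  filter_upwards [hnear, eventually_card_not_dvd_psi_le y.factorial_ne_zero hη3] with x h1 h2
  have hsub : {a ∈ Ioc 0 x | ∃ b, a < b ∧ psi a = a + b ∧ psi b = a + b} ⊆
      {a ∈ Ioc 0 x | 2 < psiRatio a ∧ psiRatio a ≤ 2 + δ} ∪
      {a ∈ Ioc 0 x | ¬ y.factorial ∣ psi a} ∪
      {a ∈ Ioc 0 x | Real.log (1 + δ) < ∑ p ∈ a.primeFactors with y < p, 1 / (p : ℝ)} := by
    intro a ha
    obtain ⟨hax, b, hab, hpa, hpb⟩ := mem_filter.mp ha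
    simp only [mem_union, mem_filter, hax, true_and]
    by_contra! hcon
    obtain ⟨⟨hratio, hdvd⟩, hlarge⟩ := hcon
    obtain ⟨hlt, hle⟩ := psiRatio_near_two_of_amicable hδ (mem_Ioc.mp hax).1 hab hpa hpb
      (hpa ▸ hdvd) hlarge
    exact (hratio hlt).not_ge hle
  have hcard := (M_le_card x).trans ((card_le_card hsub).trans
    ((card_union_le _ _).trans (Nat.add_le_add_right (card_union_le _ _) _)))
  have hcard' : (M x : ℝ) ≤ #{a ∈ Ioc 0 x | 2 < psiRatio a ∧ psiRatio a ≤ 2 + δ} +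
      #{a ∈ Ioc 0 x | ¬ y.factorial ∣ psi a} +
      #{a ∈ Ioc 0 x | Real.log (1 + δ) < ∑ p ∈ a.primeFactors with y < p, 1 / (p : ℝ)} := by
    exact_mod_cast hcard
  linarith [hy x]

end PsiRatio

/-- The number of ψ-amicable pairs `(a, b)` with `a < b ` and `a ≤ n` is `o(n)`. -/
theorem psi_amicable_density_zero :
    Tendsto (fun n : ℕ => (M n : ℝ) / n) atTop (nhds 0) := by
  rw [Metric.tendsto_nhds]
  intro ε hε
  filter_upwards [eventually_M_le (half_pos hε), eventually_gt_atTop 0] with n hn hn0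
  have hnR : (0 : ℝ) < n := mod_cast hn0
  rw [Real.dist_eq, sub_zero, abs_of_nonneg (by positivity), div_lt_iff₀ hnR]
  linarith [mul_pos hε hnR]
end

section
/- The number of positive integers m ≤ n which fail at least one of the following three conditions is o(n / (log n)²) as n → ∞: (1) if p^a exactly divides m with a > 1, then p^a < (log n)^10; (2) the number of distinct prime factors of m is less than 10·log log n; (3) the greatest prime factor of m is greater than n^{1/(20·log log n)}. -/
open Filter

/-- Few integers up to `n` are divisible by the square of an integer `d ≥ D`. -/
theorem card_le_of_exists_sq_dvd (n : ℕ) {D : ℝ} (hD : 0 < D) (S : Finset ℕ)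
    (hS : ∀ m ∈ S, m ∈ Finset.Icc 1 n ∧ ∃ d : ℕ, D ≤ d ∧ d ^ 2 ∣ m) :
    (S.card : ℝ) ≤ 2 * n / D := by
  set k := ⌈D⌉₊ with hk
  have hk0 : 0 < k := Nat.ceil_pos.mpr hD
  have hsub : S ⊆ (Finset.Ioo (k - 1) (n + 1)).biUnion
      (fun d => (Finset.Ioc 0 n).filter (d ^ 2 ∣ ·)) := by
    intro m hm
    obtain ⟨hmn, d, hDd, hdvd⟩ := hS m hm
    rw [Finset.mem_Icc] at hmn
    have hkd : k ≤ d := Nat.ceil_le.mpr hDd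
    have hdm : d ^ 2 ≤ m := Nat.le_of_dvd (by lia) hdvd
    have hdd : d ≤ d ^ 2 := Nat.le_self_pow two_ne_zero d
    simp only [Finset.mem_biUnion, Finset.mem_Ioo, Finset.mem_filter, Finset.mem_Ioc]
    exact ⟨d, ⟨by lia, by lia⟩, ⟨by lia, by lia⟩, hdvd⟩
  have hcast : ((k - 1 : ℕ) : ℝ) + 1 = k := by
    exact_mod_cast Nat.sub_add_cancel hk0
  calc (S.card : ℝ)
      ≤ ∑ d ∈ Finset.Ioo (k - 1) (n + 1), (((Finset.Ioc 0 n).filter (d ^ 2 ∣ ·)).card : ℝ) := by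
        exact_mod_cast (Finset.card_le_card hsub).trans Finset.card_biUnion_le
    _ ≤ ∑ d ∈ Finset.Ioo (k - 1) (n + 1), (n : ℝ) * ((d : ℝ) ^ 2)⁻¹ := by
        refine Finset.sum_le_sum fun d _ => ?_
        rw [Nat.Ioc_filter_dvd_card_eq_div, ← div_eq_mul_inv]
        exact_mod_cast Nat.cast_div_le (α := ℝ) (m := n) (n := d ^ 2)
    _ = n * ∑ d ∈ Finset.Ioo (k - 1) (n + 1), ((d : ℝ) ^ 2)⁻¹ := by rw [Finset.mul_sum]
    _ ≤ n * (2 / (((k - 1 : ℕ) : ℝ) + 1)) := by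
        gcongr
        exact sum_Ioo_inv_sq_le _ _
    _ = 2 * n / k := by rw [hcast]; ring
    _ ≤ 2 * n / D := by
        gcongr
        exact Nat.le_ceil D

/-- Few integers up to `n` are divisible by a large proper prime power. -/
theorem card_le_of_exists_prime_pow_dvd (n : ℕ) {T : ℝ} (hT : 1 ≤ T) (S : Finset ℕ)
    (hS : ∀ m ∈ S, m ∈ Finset.Icc 1 n ∧ ∃ p a : ℕ, p.Prime ∧ 1 < a ∧ p ^ a ∣ m ∧
      T ^ 10 ≤ ((p ^ a : ℕ) : ℝ)) :
    (S.card : ℝ) ≤ 2 * n / T ^ 3 := by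
  refine card_le_of_exists_sq_dvd n (by positivity) S fun m hm => ?_
  obtain ⟨hmn, p, a, hp, ha, hdvd, hle⟩ := hS m hm
  refine ⟨hmn, p ^ (a / 2), ?_, ?_⟩
  · refine le_of_pow_le_pow_left₀ three_ne_zero (by positivity) ?_
    calc (T ^ 3) ^ 3 = T ^ 9 := by ring
      _ ≤ T ^ 10 := pow_le_pow_right₀ hT (by norm_num)
      _ ≤ ((p ^ a : ℕ) : ℝ) := hle
      _ ≤ ((p ^ (a / 2 * 3) : ℕ) : ℝ) := by
        exact_mod_cast Nat.pow_le_pow_right hp.pos (by lia)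
      _ = ((p ^ (a / 2) : ℕ) : ℝ) ^ 3 := by push_cast; ring
  · rw [← pow_mul]
    exact (pow_dvd_pow p (by lia)).trans hdvd

theorem two_pow_card_primeFactors_le_card_divisors {m : ℕ} (hm : m ≠ 0) :
    2 ^ m.primeFactors.card ≤ m.divisors.card := by
  rw [Nat.card_divisors hm]
  refine Finset.pow_card_le_prod _ _ _ fun p hp => ?_
  have := (Nat.prime_of_mem_primeFactors hp).factorization_pos_of_dvd hm
    (Nat.dvd_of_mem_primeFactors hp)
  lia

theorem sum_card_divisors_le (n : ℕ) :
    ∑ m ∈ Finset.Ioc 0 n, (m.divisors.card : ℝ) ≤ n * (1 + Real.log n) := by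
  have h := ArithmeticFunction.sum_Ioc_sigma0_eq_sum_div n
  simp only [ArithmeticFunction.sigma_zero_apply] at h
  calc ∑ m ∈ Finset.Ioc 0 n, (m.divisors.card : ℝ)
      = ∑ d ∈ Finset.Ioc 0 n, ((n / d : ℕ) : ℝ) := by exact_mod_cast h
    _ ≤ ∑ d ∈ Finset.Ioc 0 n, (n : ℝ) * (d : ℝ)⁻¹ :=
        Finset.sum_le_sum fun d _ => by
          rw [← div_eq_mul_inv]
          exact Nat.cast_div_le
    _ = n * (harmonic n : ℝ) := by
        rw [← Finset.mul_sum, harmonic_eq_sum_Icc]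
        push_cast
        rfl
    _ ≤ n * (1 + Real.log n) := by
        gcongr
        exact harmonic_le_one_add_log n

/-- Few integers up to `n` have many distinct prime factors. -/
theorem card_le_of_le_card_primeFactors (n : ℕ) (k : ℝ) (S : Finset ℕ)
    (hS : ∀ m ∈ S, m ∈ Finset.Icc 1 n ∧ k ≤ m.primeFactors.card) :
    (S.card : ℝ) ≤ n * (1 + Real.log n) / 2 ^ k := by
  rw [le_div_iff₀ (by positivity)]
  calc (S.card : ℝ) * 2 ^ k = ∑ _m ∈ S, (2 : ℝ) ^ k := by simp
    _ ≤ ∑ m ∈ S, (m.divisors.card : ℝ) := by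
        refine Finset.sum_le_sum fun m hm => ?_
        obtain ⟨hmn, hk⟩ := hS m hm
        rw [Finset.mem_Icc] at hmn
        calc (2 : ℝ) ^ k ≤ 2 ^ (m.primeFactors.card : ℝ) :=
              Real.rpow_le_rpow_of_exponent_le one_le_two hk
          _ = ((2 ^ m.primeFactors.card : ℕ) : ℝ) := by
              rw [Real.rpow_natCast]; push_cast; rfl
          _ ≤ m.divisors.card := by
              exact_mod_cast two_pow_card_primeFactors_le_card_divisors (by lia)
    _ ≤ ∑ m ∈ Finset.Ioc 0 n, (m.divisors.card : ℝ) :=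
        Finset.sum_le_sum_of_subset_of_nonneg (fun m hm => (hS m hm).1)
          fun _ _ _ => by positivity
    _ ≤ n * (1 + Real.log n) := sum_card_divisors_le n

theorem Nat.cast_le_pow_card_primeFactors {m : ℕ} (hm : m ≠ 0) {y : ℝ}
    (hy : ∀ p ∈ m.primeFactors, ((p ^ m.factorization p : ℕ) : ℝ) ≤ y) :
    (m : ℝ) ≤ y ^ m.primeFactors.card := by
  calc (m : ℝ) = ∏ p ∈ m.primeFactors, ((p ^ m.factorization p : ℕ) : ℝ) := by
        exact_mod_cast Nat.prod_primeFactors_pow_factorization hm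
    _ ≤ ∏ _p ∈ m.primeFactors, y :=
        Finset.prod_le_prod (fun _ _ => by positivity) hy
    _ = y ^ m.primeFactors.card := by simp

/-- If the prime factors of `m` are few and at most `n ^ (1 / (20 * log log n))`, and its proper
prime powers are small, then `m ≤ √n`. -/
theorem le_sqrt_of_smooth {n m : ℕ} (hm : m ≠ 0) (hn : 1 ≤ n)
    (hlog : 1 ≤ Real.log n) (hloglog : 0 < Real.log (Real.log n))
    (hlarge : 200 * Real.log (Real.log n) ^ 2 ≤ Real.log n)
    (hpow : ∀ p a : ℕ, p.Prime → 1 < a → p ^ a ∣ m → ¬ p ^ (a + 1) ∣ m →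
      ((p ^ a : ℕ) : ℝ) < Real.log n ^ 10)
    (hcard : (m.primeFactors.card : ℝ) < 10 * Real.log (Real.log n))
    (hsmooth : ∀ p ∈ m.primeFactors,
      (p : ℝ) ≤ (n : ℝ) ^ ((1 : ℝ) / (20 * Real.log (Real.log n)))) :
    (m : ℝ) ≤ √n := by
  set l := Real.log (Real.log n) with hl
  set y := (n : ℝ) ^ ((1 : ℝ) / (20 * l)) with hy
  have hn0 : (0 : ℝ) < n := by exact_mod_cast hn
  have hn1 : (1 : ℝ) ≤ n := by exact_mod_cast hn
  have hy1 : 1 ≤ y := Real.one_le_rpow hn1 (by positivity)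
  have hlogy : Real.log n ^ 10 ≤ y := by
    rw [← Real.log_le_log_iff (by positivity) (by positivity), Real.log_pow,
      hy, Real.log_rpow hn0, ← hl, one_div, inv_mul_eq_div, le_div_iff₀ (by positivity)]
    push_cast
    nlinarith
  have hfac : ∀ p ∈ m.primeFactors, ((p ^ m.factorization p : ℕ) : ℝ) ≤ y := by
    intro p hp
    have hpp := Nat.prime_of_mem_primeFactors hp
    have hpos := hpp.factorization_pos_of_dvd hm (Nat.dvd_of_mem_primeFactors hp)
    rcases Nat.lt_or_ge 1 (m.factorization p) with h | h
    · exact (hpow p _ hpp h (Nat.ordProj_dvd m p)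
        (Nat.pow_succ_factorization_not_dvd hm hpp)).le.trans hlogy
    · have : m.factorization p = 1 := by lia
      rw [this, pow_one]
      exact hsmooth p hp
  calc (m : ℝ) ≤ y ^ m.primeFactors.card := Nat.cast_le_pow_card_primeFactors hm hfac
    _ = y ^ (m.primeFactors.card : ℝ) := (Real.rpow_natCast _ _).symm
    _ ≤ y ^ (10 * l) := Real.rpow_le_rpow_of_exponent_le hy1 hcard.le
    _ = √n := by
        rw [hy, ← Real.rpow_mul hn0.le, Real.sqrt_eq_rpow]
        congr 1
        field_simp
        norm_num

/-- Eventually `log n` is large, `log log n` is small compared to it, and it is small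
compared to `n`. -/
theorem eventually_log_bounds : ∀ᶠ n : ℕ in atTop,
    2 ≤ Real.log n ∧ 0 < Real.log (Real.log n) ∧
      200 * Real.log (Real.log n) ^ 2 ≤ Real.log n ∧ Real.log n ^ 6 ≤ n := by
  have hlog : Tendsto (fun n : ℕ => Real.log n) atTop atTop :=
    Real.tendsto_log_atTop.comp tendsto_natCast_atTop_atTop
  have hloglog : Tendsto (fun n : ℕ => Real.log (Real.log n)) atTop atTop :=
    Real.tendsto_log_atTop.comp hlog
  have h2 := hlog.eventually ((Real.isLittleO_pow_log_id_atTop (n := 2)).bound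
    (show (0 : ℝ) < 1 / 200 by norm_num))
  have h6 := (tendsto_natCast_atTop_atTop (R := ℝ)).eventually
    ((Real.isLittleO_pow_log_id_atTop (n := 6)).bound zero_lt_one)
  filter_upwards [hlog.eventually_ge_atTop 2, hloglog.eventually_gt_atTop 0, h2, h6]
    with n ha hb hc hd
  refine ⟨ha, hb, ?_, ?_⟩
  · rw [id, Real.norm_of_nonneg (by positivity), Real.norm_of_nonneg (by positivity)] at hc
    linarith
  · rw [id, Real.norm_of_nonneg (by positivity), Real.norm_of_nonneg (by positivity)] at hd
    linarith

open scoped Classical in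
/-- The number of integers `m ≤ n` failing one of Erdős' three conditions is `o(n / log² n)`. -/
theorem count_exceptional_isLittleO :
    (fun n : ℕ => ((((Finset.Icc 1 n)).filter (fun m => ¬ (
        (∀ p a : ℕ, p.Prime → 1 < a → p ^ a ∣ m → ¬ p ^ (a + 1) ∣ m →
          ((p ^ a : ℕ) : ℝ) < Real.log n ^ 10) ∧
        ((m.primeFactors.card : ℝ) < 10 * Real.log (Real.log n)) ∧
        (∃ p ∈ m.primeFactors, (n : ℝ) ^ ((1 : ℝ) / (20 * Real.log (Real.log n))) < p)))).card : ℝ))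
      =o[atTop] (fun n : ℕ => (n : ℝ) / Real.log n ^ 2) := by
  have hO : (fun n : ℕ => (n : ℝ) / Real.log n ^ 3) =o[atTop]
      (fun n : ℕ => (n : ℝ) / Real.log n ^ 2) := by
    have hlog : Tendsto (fun n : ℕ => Real.log n) atTop atTop :=
      Real.tendsto_log_atTop.comp tendsto_natCast_atTop_atTop
    refine Asymptotics.isLittleO_iff_exists_eq_mul.mpr
      ⟨fun n : ℕ => (Real.log n)⁻¹, hlog.inv_tendsto_atTop, Eventually.of_forall fun n => ?_⟩
    simp only [Pi.mul_apply]
    ring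
  refine Asymptotics.IsBigO.trans_isLittleO (Asymptotics.IsBigO.of_bound 4 ?_) hO
  filter_upwards [eventually_log_bounds, eventually_ge_atTop 1]
    with n ⟨hL, hl, hlL, hLn⟩ hn
  have hL0 : 0 < Real.log n := by linarith
  rw [Real.norm_of_nonneg (by positivity), Real.norm_of_nonneg (by positivity)]
  set A := (Finset.Icc 1 n).filter fun m => ∃ p a : ℕ, p.Prime ∧ 1 < a ∧ p ^ a ∣ m ∧
    Real.log n ^ 10 ≤ ((p ^ a : ℕ) : ℝ)
  set B := (Finset.Icc 1 n).filter fun m =>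
    10 * Real.log (Real.log n) ≤ (m.primeFactors.card : ℝ)
  have hA : (A.card : ℝ) ≤ 2 * n / Real.log n ^ 3 :=
    card_le_of_exists_prime_pow_dvd n (by linarith) A fun m hm => Finset.mem_filter.mp hm
  have hB : (B.card : ℝ) ≤ n / Real.log n ^ 3 := by
    refine (card_le_of_le_card_primeFactors n _ B
      fun m hm => Finset.mem_filter.mp hm).trans ?_
    have hpow : Real.log n ^ 6 ≤ (2 : ℝ) ^ (10 * Real.log (Real.log n)) := by
      rw [← Real.log_le_log_iff (by positivity) (by positivity), Real.log_pow,
        Real.log_rpow two_pos]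
      push_cast
      nlinarith [Real.log_two_gt_d9]
    calc n * (1 + Real.log n) / 2 ^ (10 * Real.log (Real.log n))
        ≤ n * (Real.log n ^ 3) / Real.log n ^ 6 := by
          gcongr
          nlinarith [mul_pos hL0 hL0, pow_pos hL0 3]
      _ = n / Real.log n ^ 3 := by field_simp
  have hC : ((Finset.Icc 1 ⌊√(n : ℝ)⌋₊).card : ℝ) ≤ n / Real.log n ^ 3 := by
    rw [Nat.card_Icc, Nat.add_sub_cancel]
    refine (Nat.floor_le (Real.sqrt_nonneg _)).trans ?_
    rw [le_div_iff₀ (by positivity)]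
    have hsq : Real.log n ^ 3 ≤ √n := Real.le_sqrt_of_sq_le (by linarith [pow_mul (Real.log n) 3 2])
    calc √(n : ℝ) * Real.log n ^ 3 ≤ √n * √n := by gcongr
      _ = n := Real.mul_self_sqrt (by positivity)
  have hsub : (Finset.Icc 1 n).filter (fun m => ¬ (
        (∀ p a : ℕ, p.Prime → 1 < a → p ^ a ∣ m → ¬ p ^ (a + 1) ∣ m →
          ((p ^ a : ℕ) : ℝ) < Real.log n ^ 10) ∧
        ((m.primeFactors.card : ℝ) < 10 * Real.log (Real.log n)) ∧
        (∃ p ∈ m.primeFactors, (n : ℝ) ^ ((1 : ℝ) / (20 * Real.log (Real.log n))) < p)))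
      ⊆ A ∪ B ∪ Finset.Icc 1 ⌊√(n : ℝ)⌋₊ := by
    intro m hm
    obtain ⟨hmn, hfail⟩ := Finset.mem_filter.mp hm
    have hm1 := (Finset.mem_Icc.mp hmn).1
    by_contra hnot
    simp only [Finset.mem_union, not_or] at hnot
    obtain ⟨⟨hmA, hmB⟩, hmC⟩ := hnot
    have hpow : ∀ p a : ℕ, p.Prime → 1 < a → p ^ a ∣ m → ¬ p ^ (a + 1) ∣ m →
        ((p ^ a : ℕ) : ℝ) < Real.log n ^ 10 := fun p a hp ha hdvd _ =>
      not_le.mp fun h => hmA (Finset.mem_filter.mpr ⟨hmn, p, a, hp, ha, hdvd, h⟩)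
    have hcard : (m.primeFactors.card : ℝ) < 10 * Real.log (Real.log n) :=
      not_le.mp fun h => hmB (Finset.mem_filter.mpr ⟨hmn, h⟩)
    refine hmC (Finset.mem_Icc.mpr ⟨hm1, Nat.le_floor ?_⟩)
    refine le_sqrt_of_smooth (by lia) hn (by linarith) hl hlL hpow hcard fun p hp => ?_
    exact not_lt.mp fun h => hfail ⟨hpow, hcard, p, hp, h⟩
  calc _ ≤ ((A ∪ B ∪ Finset.Icc 1 ⌊√(n : ℝ)⌋₊).card : ℝ) := by
        exact_mod_cast Finset.card_le_card hsub
    _ ≤ A.card + B.card + (Finset.Icc 1 ⌊√(n : ℝ)⌋₊).card := by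
        exact_mod_cast (Finset.card_union_le _ _).trans
          (Nat.add_le_add_right (Finset.card_union_le _ _) _)
    _ ≤ 2 * n / Real.log n ^ 3 + n / Real.log n ^ 3 + n / Real.log n ^ 3 := by gcongr
    _ = 4 * (n / Real.log n ^ 3) := by ring
end
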